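/- There exists a constant C < ∞ such that for every N ≥ 1, every Λ ⊂ ℤ with |Λ| = 2 consisting of two adjacent sites, and every f ≥ 0 on {η ∈ ℕ^Λ : Σ_x η_x = N}, one has Ent_{ν_Λ^N}(f) ≤ C E_{ν_Λ^N}(√f, √f); that is, sup_N s(2,N) < ∞, where s(L,N) is the smallest constant such that Ent_{ν_Λ^n}(f) ≤ s(L,N) E_{ν_Λ^n}(√f,√f) for all f > 0, all segments Λ with |Λ| ≤ L and all n ≤ N. -/

import Mathlib

open scoped BigOperators

noncomputable section

/-- `cfact c k = c(k)! = c(1)⋯c(k)`, with `cfact c 0 = 1`. -/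
def cfact (c : ℕ → ℝ) : ℕ → ℝ
  | 0 => 1
  | k + 1 => cfact c k * c (k + 1)

/-- The configuration obtained from `η` by moving one particle from `x` to `y` (`x ≠ y`),
i.e. `η - δ^x + δ^y`. -/
def move (η : ℤ → ℕ) (x y : ℤ) : ℤ → ℕ :=
  fun z => if z = x then η x - 1 else if z = y then η y + 1 else η z

/-- Unnormalized weight of the canonical measure `ν_Λ^N` on configurations supported in `Λ`
with `N` particles: `∏_{x∈Λ} 1/c(η_x)!`. -/
def nuW (c : ℕ → ℝ) (Λ : Finset ℤ) (N : ℕ) : (ℤ → ℕ) → ℝ :=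
  Set.indicator {η : ℤ → ℕ | (∀ x, x ∉ Λ → η x = 0) ∧ (∑ x ∈ Λ, η x) = N}
    (fun η => ∏ x ∈ Λ, (cfact c (η x))⁻¹)

/-- Expectation with respect to the probability measure obtained by normalizing the
nonnegative weight `w`. -/
def wE (w f : (ℤ → ℕ) → ℝ) : ℝ :=
  (∑' η : ℤ → ℕ, w η * f η) / (∑' η : ℤ → ℕ, w η)

/-- Covariance `μ[f,g] = μ[f g] - μ[f] μ[g]`. -/
def wCov (w f g : (ℤ → ℕ) → ℝ) : ℝ :=
  wE w (fun η => f η * g η) - wE w f * wE w g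

/-- Entropy `Ent_μ(f) = μ[f log f] - μ[f] log μ[f]` (note `Real.log 0 = 0`, giving the
convention `0 log 0 = 0`). -/
def wEnt (w f : (ℤ → ℕ) → ℝ) : ℝ :=
  wE w (fun η => f η * Real.log (f η)) - wE w f * Real.log (wE w f)

/-- Dirichlet form of the zero-range process on `Λ`:
`E(f,g) = (1/2) Σ_{x∈Λ} Σ_{y∈Λ, |x-y|=1} μ[c(η_x) ∂_{xy}f ∂_{xy}g]`. -/
def wDir (c : ℕ → ℝ) (Λ : Finset ℤ) (w f g : (ℤ → ℕ) → ℝ) : ℝ :=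
  wE w (fun η => (1 / 2) * ∑ x ∈ Λ, ∑ y ∈ Λ,
    if |x - y| = 1 then c (η x) * ((f (move η x y) - f η) * (g (move η x y) - g η)) else 0)

/-- Weight conditioned on the event `∑_{x ∈ Λ₁} η x = n`. -/
def condW (w : (ℤ → ℕ) → ℝ) (Λ₁ : Finset ℤ) (n : ℕ) : (ℤ → ℕ) → ℝ :=
  Set.indicator {η : ℤ → ℕ | (∑ x ∈ Λ₁, η x) = n} w

/-- `h(n) = (n+1)/c(n+1)`. -/
def hfun (c : ℕ → ℝ) (n : ℕ) : ℝ := (n + 1) / c (n + 1)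


lemma hardy_step {F G S ρ : ℝ} (hρ : 0 < ρ) (hS : 0 < S ∨ (S = 0 ∧ F = 0)) :
    (G^2 - F^2) / (S + ρ) + G^2 / (S + ρ) ≤ F^2 / S + 6 * ((G - F)^2 / ρ) := by
  rcases hS with hS | ⟨rfl, rfl⟩
  · have hR : 0 < S + ρ := by positivity
    rw [← sub_nonneg]
    have h2 : F^2 / S + 6 * ((G - F)^2 / ρ) - ((G^2 - F^2) / (S + ρ) + G^2 / (S + ρ))
        = (F^2 * ρ * (S + ρ) + 6 * (G-F)^2 * S * (S+ρ) - (2 * G^2 - F^2) * S * ρ) / (S * ρ * (S + ρ)) := by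
      field_simp
      ring
    rw [h2]
    apply div_nonneg _ (by positivity)
    have e : F^2 * ρ * (S + ρ) + 6 * (G-F)^2 * S * (S+ρ) - (2 * G^2 - F^2) * S * ρ
      = (F * ρ - 2 * S * (G-F))^2 + 2 * (S*(G-F))^2 + 4 * (G-F)^2 * (S * ρ) := by ring
    rw [e]; positivity
  · simp
    have : 0 ≤ G^2/ρ := by positivity
    linarith

lemma hardy (M : ℕ) (G e u : ℕ → ℝ) (B : ℝ) (hB : 0 ≤ B) (hG : G 0 = 0)
    (he : ∀ j < M, 0 < e (j+1)) (hu : ∀ j ≤ M, 0 ≤ u j)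
    (hU : ∀ n < M, (∑ k ∈ Finset.Ico (n+1) (M+1), u k) * (∑ j ∈ Finset.range (n+1), 1 / e (j+1)) ≤ B) :
    ∑ k ∈ Finset.range (M+1), u k * G k ^ 2 ≤
      6 * B * ∑ i ∈ Finset.range M, e (i+1) * (G (i+1) - G i)^2 := by
  set H : ℕ → ℝ := fun n => ∑ i ∈ Finset.range n, |G (i+1) - G i| with hH
  set R : ℕ → ℝ := fun n => ∑ j ∈ Finset.range n, 1 / e (j+1) with hR
  have H0 : H 0 = 0 := by simp [hH]
  have Hs : ∀ n, H (n+1) = H n + |G (n+1) - G n| := fun n => by simp [hH, Finset.sum_range_succ]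
  have Hn : ∀ n, 0 ≤ H n := fun n => Finset.sum_nonneg fun _ _ => abs_nonneg _
  have GH : ∀ n, |G n| ≤ H n := by
    intro n
    induction n with
    | zero => simp [hG, H0]
    | succ n ih =>
      rw [Hs]
      have := abs_add_le (G n) (G (n+1) - G n)
      rw [add_sub_cancel] at this
      linarith
  have Rs : ∀ n, R (n+1) = R n + 1 / e (n+1) := fun n => by simp [hR, Finset.sum_range_succ]
  have Rpos : ∀ n, n ≤ M → n ≠ 0 → 0 < R n := by
    intro n hn h0
    apply Finset.sum_pos
    · intro i hi
      have := he i (by have := Finset.mem_range.1 hi; omega)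
      positivity
    · simpa using h0
  have tele : ∀ n ≤ M, ∑ i ∈ Finset.range n, (H (i+1)^2 - H i^2) / R (i+1) + H n ^2 / R n ≤
      6 * ∑ i ∈ Finset.range n, e (i+1) * (G (i+1) - G i)^2 := by
    intro n
    induction n with
    | zero => simp [H0]
    | succ n ih =>
      intro hn
      have ih := ih (by omega)
      rw [Finset.sum_range_succ, Finset.sum_range_succ]
      have hen := he n (by omega)
      have := hardy_step (F := H n) (G := H (n+1)) (S := R n) (ρ := 1 / e (n+1)) (by positivity) (by
        rcases Nat.eq_zero_or_pos n with h | h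
        · right; subst h; simp [H0, hR]
        · left; exact Rpos n (by omega) (by omega))
      rw [← Rs] at this
      have h3 : (H (n+1) - H n)^2 / (1 / e (n+1)) = e (n+1) * (G (n+1) - G n)^2 := by
        rw [Hs, add_sub_cancel_left, sq_abs]; field_simp
      rw [h3] at this
      linarith
  have swap : ∑ k ∈ Finset.range (M+1), u k * H k ^ 2 =
      ∑ i ∈ Finset.range M, (∑ k ∈ Finset.Ico (i+1) (M+1), u k) * (H (i+1)^2 - H i^2) := by
    have : ∀ k, H k ^ 2 = ∑ i ∈ Finset.range k, (H (i+1)^2 - H i^2) := by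
      intro k
      rw [Finset.sum_range_sub (fun i => H i ^2)]; simp [H0]
    calc _ = ∑ k ∈ Finset.range (M+1), ∑ i ∈ Finset.range k, u k * (H (i+1)^2 - H i^2) := by
          apply Finset.sum_congr rfl; intro k _; rw [this k, Finset.mul_sum]
      _ = ∑ i ∈ Finset.range M, ∑ k ∈ Finset.Ico (i+1) (M+1), u k * (H (i+1)^2 - H i^2) := by
          apply Finset.sum_comm'
          intro x y; simp only [Finset.mem_range, Finset.mem_Ico]; omega
      _ = _ := by
          apply Finset.sum_congr rfl; intro k _; rw [Finset.sum_mul]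
  calc _ ≤ ∑ k ∈ Finset.range (M+1), u k * H k ^ 2 := by
        apply Finset.sum_le_sum; intro k hk
        apply mul_le_mul_of_nonneg_left _ (hu k (by have := Finset.mem_range.1 hk; omega))
        rw [← sq_abs (G k)]
        exact pow_le_pow_left₀ (abs_nonneg _) (GH k) 2
    _ = _ := swap
    _ ≤ ∑ i ∈ Finset.range M, B * ((H (i+1)^2 - H i^2) / R (i+1)) := by
        apply Finset.sum_le_sum; intro i hi
        have hi := Finset.mem_range.1 hi
        have hr := Rpos (i+1) (by omega) (by omega)
        have h1 := hU i hi
        have h2 : 0 ≤ H (i+1)^2 - H i^2 := by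
          have := Hs i; have := Hn i; have := abs_nonneg (G (i+1) - G i); nlinarith
        have h3 : (∑ k ∈ Finset.Ico (i+1) (M+1), u k) ≤ B / R (i+1) := by
          rw [le_div_iff₀ hr]; exact h1
        calc _ ≤ B / R (i+1) * (H (i+1)^2 - H i^2) := mul_le_mul_of_nonneg_right h3 h2
          _ = _ := by ring
    _ = B * ∑ i ∈ Finset.range M, ((H (i+1)^2 - H i^2) / R (i+1)) := by rw [Finset.mul_sum]
    _ ≤ B * (6 * ∑ i ∈ Finset.range M, e (i+1) * (G (i+1) - G i)^2) := by
        apply mul_le_mul_of_nonneg_left _ hB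
        have := tele M le_rfl
        have h4 : 0 ≤ H M ^2 / R M := by
          apply div_nonneg (by positivity)
          apply Finset.sum_nonneg; intro i hi
          have := he i (Finset.mem_range.1 hi); positivity
        linarith
    _ = _ := by ring

lemma geom_exp (x : ℝ) (hx : 0 < x) (n : ℕ) :
    ∑ i ∈ Finset.range n, Real.exp (-(x * i)) ≤ 1 + 1 / x := by
  have hr : Real.exp (-x) ≤ 1 / (1 + x) := by
    rw [Real.exp_neg, ← one_div]
    apply one_div_le_one_div_of_le (by positivity)
    linarith [Real.add_one_le_exp x]
  have hr1 : 1 / (1+x) < 1 := by rw [div_lt_one (by positivity)]; linarith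
  have : ∀ i : ℕ, Real.exp (-(x * i)) = Real.exp (-x) ^ i := by
    intro i; rw [← Real.exp_nat_mul]; congr 1; ring
  simp_rw [this]
  have h0 := Real.exp_pos (-x)
  have := geom_sum_eq (x := Real.exp (-x)) (by linarith) n
  rw [this]
  rw [← neg_div_neg_eq, div_le_iff₀ (by linarith)]
  have : 0 ≤ Real.exp (-x) ^ n := by positivity
  have : (1 + 1/x) * (1 - 1/(1+x)) = 1 := by field_simp; ring
  have : (1 + 1/x) * (1 - 1/(1+x)) ≤ (1 + 1/x) * (1 - Real.exp (-x)) := by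
    apply mul_le_mul_of_nonneg_left (by linarith) (by positivity)
  linarith

/-- pointwise entropy bound -/
lemma ent_pt {a g s : ℝ} (ha : 0 ≤ a) (hs : 0 < s) (hf : 0 ≤ a + g) :
    (a+g)^2 * Real.log ((a+g)^2) - (a+g)^2 * Real.log (a^2+s) - (a+g)^2 + (a^2 + s) ≤
      18 * g^2 + 2 * s + 4 * g^2 * Real.log (1 + 4 * g^2 / s) := by
  have ht : 0 < a^2 + s := by positivity
  have hlog : 0 ≤ Real.log (1 + 4 * g^2 / s) := by
    apply Real.log_nonneg; have : 0 ≤ 4 * g^2 / s := by positivity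
    linarith
  rcases hf.eq_or_lt with h0 | hpos
  · rw [← h0]; simp
    have : g = -a := by linarith
    subst this
    have : 0 ≤ 4 * (-a)^2 * Real.log (1 + 4 * (-a)^2 / s) := by positivity
    simp at this
    nlinarith
  · have e : (a+g)^2 * Real.log ((a+g)^2) - (a+g)^2 * Real.log (a^2+s)
        = (a+g)^2 * Real.log ((a+g)^2/(a^2+s)) := by
      rw [Real.log_div (by positivity) (by positivity)]; ring
    rw [e]
    have hq : 0 < (a+g)^2/(a^2+s) := by positivity
    rcases le_or_gt g a with h | h
    · have h1 : (a+g)^2 * Real.log ((a+g)^2/(a^2+s)) ≤ (a+g)^2 * ((a+g)^2/(a^2+s) - 1) :=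
        mul_le_mul_of_nonneg_left (Real.log_le_sub_one_of_pos hq) (by positivity)
      have h2 : (a+g)^2 * ((a+g)^2/(a^2+s) - 1) - (a+g)^2 + (a^2 + s)
          = (2*a*g+g^2 - s)^2 / (a^2+s) := by field_simp; ring
      have h3 : (2*a*g+g^2 - s)^2 / (a^2+s) ≤ 18 * g^2 + 2 * s := by
        rw [div_le_iff₀ ht]
        have : (2*a+g)^2 ≤ 9 * a^2 := by nlinarith
        have h5 : (2*a+g)^2 * g^2 ≤ 9 * a^2 * g^2 := mul_le_mul_of_nonneg_right this (by positivity)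
        have h6 : 0 ≤ g^2 * s := by positivity
        have h7 : 0 ≤ a^2 * s := by positivity
        nlinarith [sq_nonneg ((2*a+g)*g + s)]
      have : 0 ≤ 4 * g^2 * Real.log (1 + 4 * g^2 / s) := by positivity
      linarith
    · have hg : 0 < g := by linarith
      have h1 : Real.log ((a+g)^2/(a^2+s)) ≤ Real.log (1 + 4 * g^2 / s) := by
        apply Real.log_le_log hq
        have : (a+g)^2/(a^2+s) ≤ 4 * g^2/s := by
          apply div_le_div₀ (by positivity) _ hs (by nlinarith)
          nlinarith
        linarith
      have h2 : (a+g)^2 * Real.log ((a+g)^2/(a^2+s)) ≤ (4 * g^2) * Real.log (1 + 4 * g^2 / s) := by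
        apply (mul_le_mul_of_nonneg_left h1 (by positivity)).trans
        apply mul_le_mul_of_nonneg_right _ hlog
        nlinarith
      nlinarith [mul_nonneg ha hg.le, sq_nonneg g]

lemma ent_bound (I : Finset ℕ) (w φ : ℕ → ℝ) (a Z s : ℝ) (hw : ∀ k ∈ I, 0 ≤ w k)
    (hZ : Z = ∑ k ∈ I, w k) (hZ0 : 0 < Z) (hφ : ∀ k, 0 ≤ φ k) (ha : 0 ≤ a) (hs : 0 < s)
    (hsd : s * Z = ∑ k ∈ I, w k * (φ k - a)^2) :
    (∑ k ∈ I, w k * (φ k^2 * Real.log (φ k ^2))) / Z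
      - (∑ k ∈ I, w k * φ k^2)/Z * Real.log ((∑ k ∈ I, w k * φ k^2)/Z) ≤
    20 * ((∑ k ∈ I, w k * (1 + Real.log (1 + 4 * (φ k - a)^2 / s)) * (φ k - a)^2) / Z) := by
  set F := (∑ k ∈ I, w k * φ k^2)/Z with hF
  have ht : 0 < a^2 + s := by positivity
  have hF0 : 0 ≤ F := div_nonneg (Finset.sum_nonneg fun k hk => mul_nonneg (hw k hk) (by positivity)) hZ0.le
  have h1 : F * Real.log (a^2+s) + F - (a^2+s) ≤ F * Real.log F := by
    rcases hF0.eq_or_lt with h | h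
    · rw [← h]; simp only [zero_mul]; linarith
    · have := Real.log_le_sub_one_of_pos (x := (a^2+s)/F) (by positivity)
      rw [Real.log_div (by positivity) (by positivity)] at this
      have h3 := mul_le_mul_of_nonneg_left this h.le
      have h4 : F * ((a^2+s)/F - 1) = a^2 + s - F := by field_simp
      linarith
  have h2 : ∑ k ∈ I, w k * (φ k^2 * Real.log (φ k ^2) - φ k^2 * Real.log (a^2+s) - φ k^2 + (a^2+s))
      ≤ ∑ k ∈ I, w k * (18 * (φ k - a)^2 + 2 * s + 4 * (φ k - a)^2 * Real.log (1 + 4 * (φ k - a)^2 / s)) := by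
    apply Finset.sum_le_sum; intro k hk
    apply mul_le_mul_of_nonneg_left _ (hw k hk)
    have := ent_pt (a := a) (g := φ k - a) ha hs (by simpa using hφ k)
    rw [add_sub_cancel] at this
    exact this
  have h3 : ∑ k ∈ I, w k * (φ k^2 * Real.log (φ k ^2) - φ k^2 * Real.log (a^2+s) - φ k^2 + (a^2+s))
     = (∑ k ∈ I, w k * (φ k^2 * Real.log (φ k ^2))) - F * Z * Real.log (a^2+s) - F * Z + Z * (a^2+s) := by
    have : F * Z = ∑ k ∈ I, w k * φ k^2 := by rw [hF]; field_simp
    rw [this, hZ, Finset.sum_mul, Finset.sum_mul, ← Finset.sum_sub_distrib, ← Finset.sum_sub_distrib,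
      ← Finset.sum_add_distrib]
    apply Finset.sum_congr rfl; intro k _; ring
  have h4 : ∑ k ∈ I, w k * (18 * (φ k - a)^2 + 2 * s + 4 * (φ k - a)^2 * Real.log (1 + 4 * (φ k - a)^2 / s))
     = 18 * (s * Z) + 2 * s * Z + 4 * ∑ k ∈ I, w k * ((φ k - a)^2 * Real.log (1 + 4 * (φ k - a)^2 / s)) := by
    rw [hsd, hZ, Finset.mul_sum, Finset.mul_sum, Finset.mul_sum, ← Finset.sum_add_distrib, ← Finset.sum_add_distrib]
    apply Finset.sum_congr rfl; intro k _; ring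
  have h5 : ∑ k ∈ I, w k * (1 + Real.log (1 + 4 * (φ k - a)^2 / s)) * (φ k - a)^2
     = s * Z + ∑ k ∈ I, w k * ((φ k - a)^2 * Real.log (1 + 4 * (φ k - a)^2 / s)) := by
    rw [hsd, ← Finset.sum_add_distrib]
    apply Finset.sum_congr rfl; intro k _; ring
  have h6 : 0 ≤ ∑ k ∈ I, w k * ((φ k - a)^2 * Real.log (1 + 4 * (φ k - a)^2 / s)) := by
    apply Finset.sum_nonneg; intro k hk
    apply mul_nonneg (hw k hk)
    apply mul_nonneg (by positivity)
    apply Real.log_nonneg; have : 0 ≤ 4 * (φ k - a)^2 / s := by positivity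
    linarith
  rw [h5]
  rw [h3, h4] at h2
  have h7 : (∑ k ∈ I, w k * (φ k^2 * Real.log (φ k ^2))) / Z - (F * Real.log (a^2+s) + F - (a^2+s))
     = ((∑ k ∈ I, w k * (φ k^2 * Real.log (φ k ^2))) - F * Z * Real.log (a^2+s) - F * Z + Z * (a^2+s)) / Z := by
    field_simp; ring
  calc _ ≤ (∑ k ∈ I, w k * (φ k^2 * Real.log (φ k ^2))) / Z - (F * Real.log (a^2+s) + F - (a^2+s)) := by linarith
    _ = _ := h7
    _ ≤ _ := by
      rw [← mul_div_assoc]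
      apply div_le_div_of_nonneg_right _ hZ0.le
      linarith

/-- iterated upper bound -/
lemma iter_upper (δ C : ℝ) (hδ : 0 < δ) (hC : 0 ≤ C) (M : ℕ) (hM : 1 ≤ M) (π : ℕ → ℝ)
    (hπ : ∀ i ≤ M, 0 < π i)
    (ha : ∀ i < M, π (i+1) ≤ π i * Real.exp (-(δ * i - C) / M)) (n i : ℕ) (hni : n + i ≤ M) :
    π (n+i) ≤ Real.exp (δ/2 + C) * π n * Real.exp (-(δ * (n * i + i^2/2) / M)) := by
  have hM0 : (0:ℝ) < M := by exact_mod_cast hM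
  have key : ∀ i, n + i ≤ M →
      π (n+i) ≤ π n * Real.exp (-(δ * (n * i + i*(i-1)/2) - C * i) / M) := by
    intro i
    induction i with
    | zero => intro _; simp
    | succ i ih =>
      intro h
      have ih := ih (by omega)
      have h1 := ha (n+i) (by omega)
      calc π (n + (i+1)) ≤ π (n+i) * Real.exp (-(δ * ((n+i : ℕ):ℝ) - C) / M) := h1
        _ ≤ (π n * Real.exp (-(δ * (n * i + i*(i-1)/2) - C * i) / M)) * Real.exp (-(δ * ((n+i : ℕ):ℝ) - C) / M) :=
          mul_le_mul_of_nonneg_right ih (Real.exp_pos _).le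
        _ = _ := by
          rw [mul_assoc, ← Real.exp_add]
          congr 2
          push_cast
          field_simp
          ring
  refine (key i hni).trans ?_
  have hp := hπ n (by omega)
  rw [mul_comm (Real.exp (δ/2 + C)) (π n), mul_assoc, ← Real.exp_add]
  apply mul_le_mul_of_nonneg_left _ hp.le
  apply Real.exp_le_exp.2
  have hi : (i:ℝ) ≤ M := by exact_mod_cast (by omega : i ≤ M)
  have : (i:ℝ)/M ≤ 1 := by rw [div_le_one hM0]; exact hi
  have e : -(δ * (n * i + i*(i-1)/2) - C * i) / M = (δ/2 + C) * (i / M) - δ * (n * i + i^2/2) / M := by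
    field_simp; ring
  rw [e]
  have := mul_le_mul_of_nonneg_left this (by positivity : 0 ≤ δ/2 + C)
  linarith

lemma iter_lower (K : ℝ) (hK : 0 ≤ K) (M : ℕ) (hM : 1 ≤ M) (π : ℕ → ℝ)
    (hπ : ∀ i ≤ M, 0 < π i)
    (hb : ∀ i < M, π i ≤ π (i+1) * Real.exp (K * (i+1) / (√M * √((M:ℝ) - i)))) (n : ℕ) (hn : n ≤ M) :
    π 0 ≤ π n * Real.exp (2 * K * (n^2 / M)) := by
  have hM0 : (0:ℝ) < M := by exact_mod_cast hM
  have hs0 : 0 < √(M:ℝ) := Real.sqrt_pos.2 hM0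
  have key : ∀ n ≤ M, π 0 ≤ π n * Real.exp (2 * K * n * (√M - √((M:ℝ) - n)) / √M) := by
    intro n
    induction n with
    | zero => intro _; simp
    | succ n ih =>
      intro h
      have ih := ih (by omega)
      have h1 := hb n (by omega)
      have hnM : (n:ℝ) + 1 ≤ M := by exact_mod_cast h
      have h2 : 0 < √((M:ℝ) - n) := Real.sqrt_pos.2 (by linarith)
      have h3 : 0 ≤ √((M:ℝ) - (n+1)) := Real.sqrt_nonneg _
      have h4 : √((M:ℝ) - (n+1)) ≤ √((M:ℝ) - n) := Real.sqrt_le_sqrt (by linarith)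
      have h4' : √((M:ℝ) - n) ≤ √(M:ℝ) := Real.sqrt_le_sqrt (by linarith [(Nat.cast_nonneg n : (0:ℝ) ≤ n)])
      have s2 := Real.sq_sqrt (by linarith : (0:ℝ) ≤ (M:ℝ) - n)
      have s3 := Real.sq_sqrt (by linarith : (0:ℝ) ≤ (M:ℝ) - (n+1))
      have h5 : 1 / √((M:ℝ) - n) ≤ 2 * (√((M:ℝ) - n) - √((M:ℝ) - (n+1))) := by
        rw [div_le_iff₀ h2]
        nlinarith
      calc π 0 ≤ _ := ih
        _ ≤ (π (n+1) * Real.exp (K * (n+1) / (√M * √((M:ℝ) - n)))) * Real.exp (2 * K * n * (√M - √((M:ℝ) - n)) / √M) :=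
          mul_le_mul_of_nonneg_right h1 (Real.exp_pos _).le
        _ ≤ _ := by
          rw [mul_assoc, ← Real.exp_add]
          apply mul_le_mul_of_nonneg_left _ (hπ (n+1) h).le
          apply Real.exp_le_exp.2
          push_cast
          have e1 : K * (n+1) / (√M * √((M:ℝ) - n)) = K * (n+1) * (1 / √((M:ℝ) - n)) / √M := by
            field_simp
          rw [e1, ← add_div]
          apply div_le_div_of_nonneg_right _ hs0.le
          have h6 := mul_le_mul_of_nonneg_left h5 (by positivity : 0 ≤ K * (n+1))
          have h7 : 0 ≤ K * (√M - √((M:ℝ) - n)) := mul_nonneg hK (by linarith)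
          nlinarith
  refine (key n hn).trans ?_
  apply mul_le_mul_of_nonneg_left _ (hπ n hn).le
  apply Real.exp_le_exp.2
  have hnM : (n:ℝ) ≤ M := by exact_mod_cast hn
  have s1 := Real.sq_sqrt hM0.le
  have s2 := Real.sq_sqrt (by linarith : (0:ℝ) ≤ (M:ℝ) - n)
  have h2 : 0 ≤ √((M:ℝ) - n) := Real.sqrt_nonneg _
  have h4' : √((M:ℝ) - n) ≤ √(M:ℝ) := Real.sqrt_le_sqrt (by linarith [(Nat.cast_nonneg n : (0:ℝ) ≤ n)])
  have h8 : (√M - √((M:ℝ) - n)) / √M ≤ n / M := by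
    rw [div_le_div_iff₀ hs0 hM0]
    have : (√M - √((M:ℝ) - n)) * √M ≤ n := by nlinarith
    nlinarith
  have h9 := mul_le_mul_of_nonneg_left h8 (by positivity : 0 ≤ 2 * K * n)
  calc _ = 2 * K * n * ((√M - √((M:ℝ) - n)) / √M) := by ring
    _ ≤ _ := h9
    _ = _ := by ring

/-- Gaussian sum: total mass of a half -/
lemma half_mass (δ C : ℝ) (hδ : 0 < δ) (hC : 0 ≤ C) (M : ℕ) (hM : 1 ≤ M) (π : ℕ → ℝ)
    (hπ : ∀ i ≤ M, 0 < π i)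
    (ha : ∀ i < M, π (i+1) ≤ π i * Real.exp (-(δ * i - C) / M)) :
    ∑ i ∈ Finset.range (M+1), π i ≤ Real.exp (δ/2 + C) * Real.exp (δ/2) * (1 + 1/δ) * √M * π 0 := by
  have hM0 : (0:ℝ) < M := by exact_mod_cast hM
  have hM1 : (1:ℝ) ≤ M := by exact_mod_cast hM
  have hs0 : 0 < √(M:ℝ) := Real.sqrt_pos.2 hM0
  have hs1 : 1 ≤ √(M:ℝ) := Real.one_le_sqrt.2 hM1
  have s1 := Real.sq_sqrt hM0.le
  have hp := hπ 0 (by omega)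
  calc _ ≤ ∑ i ∈ Finset.range (M+1), (Real.exp (δ/2 + C) * π 0 * Real.exp (δ/2)) * Real.exp (-(δ/√M * i)) := by
        apply Finset.sum_le_sum; intro i hi
        have := iter_upper δ C hδ hC M hM π hπ ha 0 i (by have := Finset.mem_range.1 hi; omega)
        rw [zero_add] at this
        refine this.trans ?_
        rw [mul_assoc _ (Real.exp (δ/2)), ← Real.exp_add]
        apply mul_le_mul_of_nonneg_left _ (by positivity)
        apply Real.exp_le_exp.2
        have h : δ/2 + -(δ/√M * i) + δ * (((0:ℕ):ℝ) * i + i^2/2) / M = - (δ / 2) * (2 * (i / √M) - (i^2/M) - 1) := by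
          push_cast; field_simp; ring
        have h2 : (i:ℝ)^2 / M = (i/√M)^2 := by rw [div_pow, s1]
        rw [h2] at h
        nlinarith [mul_nonneg hδ.le (sq_nonneg ((i:ℝ)/√M - 1))]
    _ = (Real.exp (δ/2 + C) * π 0 * Real.exp (δ/2)) * ∑ i ∈ Finset.range (M+1), Real.exp (-(δ/√M * i)) := by
        rw [Finset.mul_sum]
    _ ≤ (Real.exp (δ/2 + C) * π 0 * Real.exp (δ/2)) * (1 + 1/(δ/√M)) :=
        mul_le_mul_of_nonneg_left (geom_exp _ (by positivity) _) (by positivity)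
    _ ≤ (Real.exp (δ/2 + C) * π 0 * Real.exp (δ/2)) * ((1 + 1/δ) * √M) := by
        apply mul_le_mul_of_nonneg_left _ (by positivity)
        have : 1/(δ/√M) = 1/δ * √M := by field_simp
        rw [this]; nlinarith
    _ = _ := by ring

lemma half_TR (δ C K KZ b : ℝ) (hδ : 0 < δ) (hC : 0 ≤ C) (hK : 0 ≤ K) (hKZ : 0 ≤ KZ) (hb0 : 0 < b) :
    ∃ B : ℝ, 0 ≤ B ∧ ∀ (M : ℕ) (_ : 1 ≤ M) (π e : ℕ → ℝ) (Z : ℝ) (_ : 0 < Z)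
    (_ : ∀ i ≤ M, 0 < π i)
    (_ : ∀ i < M, π (i+1) ≤ π i * Real.exp (-(δ * i - C) / M))
    (_ : ∀ i < M, π i ≤ π (i+1) * Real.exp (K * (i+1) / (√M * √((M:ℝ) - i))))
    (_ : ∀ i < M, b * M * π (i+1) ≤ e (i+1))
    (_ : Z ≤ KZ * √M * π 0) (n : ℕ) (_ : 1 ≤ n) (_ : n ≤ M),
    (∑ k ∈ Finset.Ico n (M+1), π k) * (∑ j ∈ Finset.range n, 1 / e (j+1)) * (1 + n^2/M) ≤ B ∧
    Z * (∑ j ∈ Finset.range n, 1 / e (j+1)) * Real.exp (-((2*K+1) * (n^2/M))) ≤ B := by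
  set E := Real.exp (δ/2 + C) with hE
  have hE0 : 0 < E := Real.exp_pos _
  refine ⟨max (E * (1 + 1/δ) * (E / b) * (2 + 2/δ)) (KZ * (E / b)), by positivity, ?_⟩
  intro M hM π e Z hZ hπ ha hb he hZK n hn hnM
  have hM0 : (0:ℝ) < M := by exact_mod_cast hM
  have hM1 : (1:ℝ) ≤ M := by exact_mod_cast hM
  have hn0 : (0:ℝ) < n := by exact_mod_cast hn
  have hnM' : (n:ℝ) ≤ M := by exact_mod_cast hnM
  have hs0 : 0 < √(M:ℝ) := Real.sqrt_pos.2 hM0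
  have s1 := Real.sq_sqrt hM0.le
  have hpn := hπ n hnM
  have hT : (∑ k ∈ Finset.Ico n (M+1), π k) ≤ E * π n * ((1 + 1/δ) * (M/n)) := by
    rw [Finset.sum_Ico_eq_sum_range]
    calc _ ≤ ∑ i ∈ Finset.range (M+1-n), E * π n * Real.exp (-(δ * n / M * i)) := by
          apply Finset.sum_le_sum; intro i hi
          have := iter_upper δ C hδ hC M hM π hπ ha n i (by have := Finset.mem_range.1 hi; omega)
          refine this.trans ?_
          apply mul_le_mul_of_nonneg_left _ (by positivity)
          apply Real.exp_le_exp.2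
          have : δ * (n * i + i^2/2) / M = δ * n / M * i + δ * (i^2/2) / M := by ring
          have : 0 ≤ δ * ((i:ℝ)^2/2) / M := by positivity
          linarith
      _ = E * π n * ∑ i ∈ Finset.range (M+1-n), Real.exp (-(δ * n / M * i)) := by rw [Finset.mul_sum]
      _ ≤ E * π n * (1 + 1 / (δ * n / M)) :=
          mul_le_mul_of_nonneg_left (geom_exp _ (by positivity) _) (by positivity)
      _ ≤ _ := by
          apply mul_le_mul_of_nonneg_left _ (by positivity)
          have h1 : 1 / (δ * n / M) = 1 / δ * (M/n) := by field_simp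
          have h2 : 1 ≤ (M:ℝ)/n := by rw [le_div_iff₀ hn0]; linarith
          rw [h1]; nlinarith
  set S := ∑ i ∈ Finset.range n, Real.exp (-(δ * n / (2*M) * i)) with hS
  have hS0 : 0 ≤ S := Finset.sum_nonneg fun _ _ => (Real.exp_pos _).le
  have hS1 : S ≤ n := by
    calc S ≤ ∑ i ∈ Finset.range n, (1:ℝ) := by
          apply Finset.sum_le_sum; intro i _
          apply Real.exp_le_one_iff.2
          have : 0 ≤ δ * n / (2*M) * i := by positivity
          linarith
      _ = n := by simp
  have hS2 : S * (n / M) ≤ 1 + 2/δ := by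
    have := geom_exp (δ * n / (2*M)) (by positivity) n
    rw [← hS] at this
    calc S * (n/M) ≤ (1 + 1/(δ * n / (2*M))) * (n/M) := mul_le_mul_of_nonneg_right this (by positivity)
      _ = n / M + 2/δ := by field_simp
      _ ≤ _ := by
        have : (n:ℝ)/M ≤ 1 := by rw [div_le_one hM0]; exact hnM'
        linarith
  have hR : (∑ j ∈ Finset.range n, 1 / e (j+1)) ≤ E / (b * M * π n) * S := by
    rw [← Finset.sum_range_reflect, hS, Finset.mul_sum]
    apply Finset.sum_le_sum; intro i hi
    have hi := Finset.mem_range.1 hi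
    have e1 : n - 1 - i + 1 = n - i := by omega
    have he' := he (n-1-i) (by omega)
    rw [e1] at he' ⊢
    have hp := hπ (n-i) (by omega)
    have hup := iter_upper δ C hδ hC M hM π hπ ha (n-i) i (by omega)
    rw [Nat.sub_add_cancel hi.le, ← hE, Nat.cast_sub hi.le] at hup
    have hle : Real.exp (-(δ * ((n - i) * i + i^2/2) / M)) ≤ Real.exp (-(δ * n / (2*M) * i)) := by
      apply Real.exp_le_exp.2
      have hi' : (i:ℝ) ≤ n := by exact_mod_cast hi.le
      have : -(δ * n / (2*M) * i) + (δ * ((n - i) * i + i^2/2) / M) = δ / (2 * M) * (i * (n - i)) := by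
        field_simp; ring
      have : 0 ≤ δ / (2 * M) * (i * ((n:ℝ) - i)) := by
        apply mul_nonneg (by positivity); apply mul_nonneg (by positivity); linarith
      linarith
    have h1 : π n ≤ E * π (n-i) * Real.exp (-(δ * n / (2*M) * i)) :=
      hup.trans (mul_le_mul_of_nonneg_left hle (by positivity))
    calc 1 / e (n-i) ≤ 1 / (b * M * π (n-i)) := one_div_le_one_div_of_le (by positivity) he'
      _ ≤ _ := by
        rw [div_mul_eq_mul_div, div_le_div_iff₀ (by positivity) (by positivity)]
        have := mul_le_mul_of_nonneg_left h1 (by positivity : 0 ≤ b * M)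
        linarith
  have hR0 : 0 ≤ (∑ j ∈ Finset.range n, 1 / e (j+1)) := by
    apply Finset.sum_nonneg; intro j hj
    have hj := Finset.mem_range.1 hj
    have h1 := he j (by omega)
    have h2 := hπ (j+1) (by omega)
    have : 0 < b * M * π (j+1) := by positivity
    have : 0 < e (j+1) := by linarith
    positivity
  constructor
  · refine le_trans ?_ (le_max_left _ _)
    calc _ ≤ (E * π n * ((1 + 1/δ) * (M/n))) * (E / (b * M * π n) * S) * (1 + n^2/M) := by
          apply mul_le_mul_of_nonneg_right _ (by positivity)
          apply mul_le_mul hT hR hR0 (by positivity)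
      _ = E * (1 + 1/δ) * (E / b) * (S / n + S * (n / M)) := by field_simp
      _ ≤ E * (1 + 1/δ) * (E / b) * (2 + 2/δ) := by
          apply mul_le_mul_of_nonneg_left _ (by positivity)
          have : S / n ≤ 1 := by rw [div_le_one hn0]; exact hS1
          linarith
  · refine le_trans ?_ (le_max_right _ _)
    have hlow := iter_lower K hK M hM π hπ hb n hnM
    set x := (n:ℝ)^2/M with hx
    have hx2 : x = (n/√M)^2 := by rw [div_pow, s1]
    have hy : (n/√M) ≤ Real.exp x := by
      have := Real.add_one_le_exp x
      rw [hx2] at this ⊢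
      nlinarith [sq_nonneg ((n:ℝ)/√M - 1)]
    calc _ ≤ (KZ * √M * (π n * Real.exp (2 * K * x))) * (E / (b * M * π n) * n) * Real.exp (-((2*K+1) * x)) := by
          apply mul_le_mul_of_nonneg_right _ (Real.exp_pos _).le
          apply mul_le_mul _ _ hR0 (by positivity)
          · exact hZK.trans (mul_le_mul_of_nonneg_left hlow (by positivity))
          · exact hR.trans (mul_le_mul_of_nonneg_left hS1 (by positivity))
      _ = KZ * (E/b) * (n * √M / M) * (Real.exp (2 * K * x) * Real.exp (-((2*K+1) * x))) := by
          field_simp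
      _ = KZ * (E/b) * ((n / √M) * Real.exp (-x)) := by
          rw [← Real.exp_add]
          have : n * √M / M = n / √M := by
            field_simp; rw [s1]
          rw [this]
          have : 2 * K * x + -((2*K+1) * x) = -x := by ring
          rw [this]; ring
      _ ≤ KZ * (E/b) * 1 := by
          apply mul_le_mul_of_nonneg_left _ (by positivity)
          rw [Real.exp_neg, ← div_eq_mul_inv, div_le_one (Real.exp_pos _)]
          exact hy
      _ = _ := by ring

lemma half_hardy (δ C K KZ b : ℝ) (hδ : 0 < δ) (hC : 0 ≤ C) (hK : 0 ≤ K) (hKZ : 0 ≤ KZ) (hb0 : 0 < b) :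
    ∃ B : ℝ, 0 ≤ B ∧ ∀ (M : ℕ) (_ : 1 ≤ M) (π e : ℕ → ℝ) (Z : ℝ) (_ : 0 < Z)
    (_ : ∀ i ≤ M, 0 < π i)
    (_ : ∀ i < M, π (i+1) ≤ π i * Real.exp (-(δ * i - C) / M))
    (_ : ∀ i < M, π i ≤ π (i+1) * Real.exp (K * (i+1) / (√M * √((M:ℝ) - i))))
    (_ : ∀ i < M, b * M * π (i+1) ≤ e (i+1))
    (_ : Z ≤ KZ * √M * π 0) (h g : ℕ → ℝ) (_ : ∀ i, 0 ≤ h i)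
    (_ : ∑ i ∈ Finset.range (M+1), π i * Real.exp (h i) ≤ 5 * Z) (_ : g 0 = 0),
    ∑ i ∈ Finset.range (M+1), π i * (1 + h i) * g i ^ 2 ≤
      B * ∑ i ∈ Finset.range M, e (i+1) * (g (i+1) - g i)^2 := by
  obtain ⟨B, hB, H⟩ := half_TR δ C K KZ b hδ hC hK hKZ hb0
  refine ⟨6 * ((2*K+1) * B + 5 * B), by positivity, ?_⟩
  intro M hM π e Z hZ hπ ha hb he hZK h g hh hsum hg
  have hM0 : (0:ℝ) < M := by exact_mod_cast hM
  have hepos : ∀ j < M, 0 < e (j+1) := by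
    intro j hj
    have h1 := he j hj
    have h2 := hπ (j+1) (by omega)
    have : 0 < b * M * π (j+1) := by positivity
    linarith
  apply hardy M g e (fun i => π i * (1 + h i)) _ (by positivity) hg hepos
  · intro j hj; exact mul_nonneg (hπ j hj).le (by linarith [hh j])
  · intro n hn
    obtain ⟨h1, h2⟩ := H M hM π e Z hZ hπ ha hb he hZK (n+1) (by omega) (by omega)
    set R := ∑ j ∈ Finset.range (n+1), 1 / e (j+1) with hR
    have hR0 : 0 ≤ R := by
      apply Finset.sum_nonneg; intro j hj
      have := hepos j (by have := Finset.mem_range.1 hj; omega)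
      positivity
    set x := ((n+1 : ℕ):ℝ)^2/M with hx
    have hx0 : 0 ≤ x := by positivity
    set T := ∑ k ∈ Finset.Ico (n+1) (M+1), π k with hT
    have hT0 : 0 ≤ T := Finset.sum_nonneg fun k hk => (hπ k (by have := Finset.mem_Ico.1 hk; omega)).le
    set L := (2*K+1) * x with hL
    have hU : ∑ k ∈ Finset.Ico (n+1) (M+1), π k * (1 + h k) ≤ T * (1 + L) + 5 * Z * Real.exp (-L) := by
      calc _ ≤ ∑ k ∈ Finset.Ico (n+1) (M+1), (π k * (1 + L) + π k * Real.exp (h k) * Real.exp (-L)) := by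
            apply Finset.sum_le_sum; intro k hk
            have hp := hπ k (by have := Finset.mem_Ico.1 hk; omega)
            rw [mul_assoc, ← mul_add]
            apply mul_le_mul_of_nonneg_left _ hp.le
            rw [← Real.exp_add]
            have := Real.add_one_le_exp (h k + -L)
            linarith
        _ = T * (1+L) + (∑ k ∈ Finset.Ico (n+1) (M+1), π k * Real.exp (h k)) * Real.exp (-L) := by
            rw [Finset.sum_add_distrib, Finset.sum_mul, Finset.sum_mul]
        _ ≤ _ := by
            apply add_le_add le_rfl
            apply mul_le_mul_of_nonneg_right _ (Real.exp_pos _).le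
            refine le_trans ?_ hsum
            apply Finset.sum_le_sum_of_subset_of_nonneg
            · intro k; simp only [Finset.mem_Ico, Finset.mem_range]; omega
            · intro k hk _
              have hp := hπ k (by have := Finset.mem_range.1 hk; omega)
              positivity
    have h3 : T * (1 + L) * R ≤ (2*K+1) * B := by
      calc T * (1 + L) * R = T * R * (1+L) := by ring
        _ ≤ T * R * ((2*K+1) * (1 + x)) := by
          apply mul_le_mul_of_nonneg_left _ (by positivity)
          rw [hL]; nlinarith
        _ = (2*K+1) * (T * R * (1+x)) := by ring
        _ ≤ _ := mul_le_mul_of_nonneg_left h1 (by positivity)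
    calc _ ≤ (T * (1 + L) + 5 * Z * Real.exp (-L)) * R := mul_le_mul_of_nonneg_right hU hR0
      _ = T * (1 + L) * R + 5 * (Z * R * Real.exp (-L)) := by ring
      _ ≤ _ := by linarith

lemma c_incr (c : ℕ → ℝ) (a₁ a₂ : ℝ) (k₀ : ℕ)
    (hLG : ∀ k : ℕ, |c (k + 1) - c k| ≤ a₁) (l d : ℕ) : |c (l + d) - c l| ≤ a₁ * d := by
  induction d with
  | zero => simp
  | succ d ih =>
    have h := hLG (l+d)
    have := abs_sub_le (c (l + d + 1)) (c (l+d)) (c l)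
    push_cast
    rw [← add_assoc]
    linarith

lemma c_lower (c : ℕ → ℝ) (a₁ a₂ : ℝ) (k₀ : ℕ)
    (hLG : ∀ k : ℕ, |c (k + 1) - c k| ≤ a₁)
    (hk₀ : 0 < k₀) (ha₂ : 0 < a₂)
    (hM : ∀ j k : ℕ, j + k₀ ≤ k → a₂ ≤ c k - c j) (l d : ℕ) :
    a₂ / k₀ * d - (a₁ * k₀ + a₂) ≤ c (l+d) - c l := by
  have hk : (0:ℝ) < k₀ := by exact_mod_cast hk₀
  have ha1 : 0 ≤ a₁ := (abs_nonneg _).trans (hLG 0)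
  induction d using Nat.strong_induction_on with
  | _ d ih =>
    by_cases h : d < k₀
    · have h1 := c_incr c a₁ a₂ k₀ hLG l d
      have h2 := (abs_le.1 h1).1
      have hd : (d:ℝ) ≤ k₀ := by exact_mod_cast h.le
      have h3 : a₂ / k₀ * d ≤ a₂ := by
        rw [div_mul_eq_mul_div, div_le_iff₀ hk]; nlinarith
      have := mul_le_mul_of_nonneg_left hd ha1
      linarith
    · push Not at h
      have h1 := ih (d - k₀) (by omega)
      have h2 := hM (l + (d - k₀)) (l + d) (by omega)
      rw [Nat.cast_sub h] at h1
      have : a₂ / k₀ * ((d:ℝ) - k₀) = a₂ / k₀ * d - a₂ := by field_simp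
      linarith

lemma c_lin (c : ℕ → ℝ) (a₁ a₂ : ℝ) (k₀ : ℕ)
    (hc0 : c 0 = 0) (hcpos : ∀ n : ℕ, 0 < n → 0 < c n)
    (hLG : ∀ k : ℕ, |c (k + 1) - c k| ≤ a₁)
    (hk₀ : 0 < k₀) (ha₂ : 0 < a₂)
    (hM : ∀ j k : ℕ, j + k₀ ≤ k → a₂ ≤ c k - c j) :
    ∃ b : ℝ, 0 < b ∧ ∀ k : ℕ, b * k ≤ c k := by
  have hk : (0:ℝ) < k₀ := by exact_mod_cast hk₀
  -- minimum over the first positive values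
  obtain ⟨b₁, hb₁, hb⟩ : ∃ b₁ : ℝ, 0 < b₁ ∧ ∀ k : ℕ, k < k₀ → b₁ * k ≤ c k := by
    have : ∀ n : ℕ, ∃ b₁ : ℝ, 0 < b₁ ∧ ∀ k : ℕ, k < n → b₁ * k ≤ c k := by
      intro n
      induction n with
      | zero => exact ⟨1, one_pos, by simp⟩
      | succ n ih =>
        obtain ⟨b, hb, h⟩ := ih
        rcases Nat.eq_zero_or_pos n with h0 | h0
        · refine ⟨1, one_pos, ?_⟩
          intro k hk
          have : k = 0 := by omega
          subst this; simp [hc0]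
        · have hcn := hcpos n h0
          have hn : (0:ℝ) < n := by exact_mod_cast h0
          refine ⟨min b (c n / n), by positivity, ?_⟩
          intro k hk
          rcases Nat.lt_succ_iff_lt_or_eq.1 hk with h1 | h1
          · refine le_trans ?_ (h k h1)
            exact mul_le_mul_of_nonneg_right (min_le_left _ _) (by positivity)
          · subst h1
            refine le_trans (mul_le_mul_of_nonneg_right (min_le_right _ _) hn.le) ?_
            field_simp; exact le_rfl
    exact this k₀
  refine ⟨min b₁ (a₂ / k₀), by positivity, ?_⟩
  intro k
  induction k using Nat.strong_induction_on with
  | _ d ih =>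
    by_cases h : d < k₀
    · exact le_trans (mul_le_mul_of_nonneg_right (min_le_left _ _) (by positivity)) (hb d h)
    · push Not at h
      have h1 := ih (d - k₀) (by omega)
      have h2 := hM (d - k₀) d (by omega)
      rw [Nat.cast_sub h] at h1
      have h3 : min b₁ (a₂ / k₀) * k₀ ≤ a₂ / k₀ * k₀ := mul_le_mul_of_nonneg_right (min_le_right _ _) hk.le
      have h4 : a₂ / k₀ * k₀ = a₂ := by field_simp
      nlinarith

/-- weights of a half -/
def hw (c : ℕ → ℝ) (m M i : ℕ) : ℝ := (cfact c (m+i))⁻¹ * (cfact c (M-i))⁻¹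

lemma cfact_pos (c : ℕ → ℝ) (hcpos : ∀ n : ℕ, 0 < n → 0 < c n) (k : ℕ) : 0 < cfact c k := by
  induction k with
  | zero => simp [cfact]
  | succ k ih => exact mul_pos ih (hcpos _ (by omega))

lemma hw_pos (c : ℕ → ℝ) (hcpos : ∀ n : ℕ, 0 < n → 0 < c n) (m M i : ℕ) : 0 < hw c m M i :=
  mul_pos (inv_pos.2 (cfact_pos c hcpos _)) (inv_pos.2 (cfact_pos c hcpos _))

lemma hw_succ (c : ℕ → ℝ) (hcpos : ∀ n : ℕ, 0 < n → 0 < c n) (m M i : ℕ) (hi : i < M) :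
    hw c m M (i+1) * c (m+i+1) = hw c m M i * c (M-i) := by
  obtain ⟨t, ht⟩ : ∃ t, M - i = t + 1 := ⟨M - i - 1, by omega⟩
  have ht' : M - (i+1) = t := by omega
  unfold hw
  rw [ht, ht', ← add_assoc]
  simp only [cfact]
  have h1 := cfact_pos c hcpos (m+i)
  have h2 := cfact_pos c hcpos t
  have h3 := hcpos (m+i+1) (by omega)
  have h4 := hcpos (t+1) (by omega)
  field_simp

lemma ratio_low {K₁ M i : ℝ} (hK : 0 ≤ K₁) (hM : 1 ≤ M) (hi : 0 ≤ i) (hiM : i + 1 ≤ M) :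
    1 + K₁ * ((i+1)/(M-i)) ≤ Real.exp ((2*K₁+2) * (i+1) / (√M * √(M-i))) := by
  have ht : 0 < M - i := by linarith
  have hM0 : 0 < M := by linarith
  set z := (i+1) / (√M * √(M-i)) with hz
  set y := (i+1)/(M-i) with hy
  have h1 : 0 < √M := Real.sqrt_pos.2 hM0
  have h2 : 0 < √(M-i) := Real.sqrt_pos.2 ht
  have s1 := Real.sq_sqrt hM0.le
  have s2 := Real.sq_sqrt ht.le
  have hz0 : 0 ≤ z := by positivity
  have hyz : y ≤ 2 * z + 2 * z^2 := by
    by_cases h : M ≤ 2 * (i+1)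
    · have : z^2 = (i+1)^2 / (M * (M-i)) := by rw [hz, div_pow, mul_pow, s1, s2]
      have : y ≤ 2 * z^2 := by
        rw [this, hy, ← mul_div_assoc, div_le_div_iff₀ ht (by positivity)]
        have := mul_le_mul_of_nonneg_left h (by positivity : 0 ≤ (i+1) * (M-i))
        nlinarith
      linarith
    · push Not at h
      have h4 : √M ≤ 2 * √(M-i) := by
        apply abs_le_of_sq_le_sq' _ (by positivity) |>.2
        nlinarith
      have : y ≤ 2 * z := by
        rw [hz, hy, ← mul_div_assoc, div_le_div_iff₀ ht (by positivity)]
        have : √M * √(M-i) ≤ 2 * (M-i) := by nlinarith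
        nlinarith
      nlinarith
  have e : (2*K₁+2) * (i+1) / (√M * √(M-i)) = (2*K₁+2) * z := by rw [hz]; ring
  rw [e]
  have := Real.quadratic_le_exp_of_nonneg (x := (2*K₁+2) * z) (by positivity)
  have h5 := mul_le_mul_of_nonneg_left hyz hK
  have h6 : 0 ≤ z^2 := by positivity
  have h7 : 0 ≤ K₁^2 * z^2 := by positivity
  have h8 : 0 ≤ K₁ * z^2 := by positivity
  nlinarith

lemma hw_bounds (c : ℕ → ℝ) (a₁ a₂ : ℝ) (k₀ : ℕ)
    (hc0 : c 0 = 0) (hcpos : ∀ n : ℕ, 0 < n → 0 < c n)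
    (hLG : ∀ k : ℕ, |c (k + 1) - c k| ≤ a₁)
    (hk₀ : 0 < k₀) (ha₂ : 0 < a₂)
    (hM : ∀ j k : ℕ, j + k₀ ≤ k → a₂ ≤ c k - c j) :
    ∃ δ C K b : ℝ, 0 < δ ∧ 0 ≤ C ∧ 0 ≤ K ∧ 0 < b ∧ ∀ m M : ℕ, m ≤ M + 1 → M ≤ m + 1 →
      ∀ i < M, hw c m M (i+1) ≤ hw c m M i * Real.exp (-(δ * i - C) / M) ∧
       hw c m M i ≤ hw c m M (i+1) * Real.exp (K * (i+1) / (√M * √((M:ℝ) - i))) ∧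
       b * M * hw c m M (i+1) ≤ hw c m M (i+1) * c (m+i+1) := by
  obtain ⟨b, hb, hbc⟩ := c_lin c a₁ a₂ k₀ hc0 hcpos hLG hk₀ ha₂ hM
  have hk : (0:ℝ) < k₀ := by exact_mod_cast hk₀
  have ha1 : 0 < a₁ := by
    have h1 := hLG 0
    have h2 := hcpos 1 one_pos
    rw [hc0, zero_add, sub_zero, abs_of_pos h2] at h1
    linarith
  set C₀ := a₁ * k₀ + a₂ with hC₀
  refine ⟨2 * (a₂/k₀) / (3 * a₁), C₀ / b, 2 * (2 * a₁ / b) + 2, b, by positivity, by positivity,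
    by positivity, hb, ?_⟩
  intro m M hm1 hm2 i hi
  have hM0 : (0:ℝ) < M := by exact_mod_cast (by omega : 0 < M)
  have hp := hcpos (m+i+1) (by omega)
  have hq := hcpos (M-i) (by omega)
  have hs := hw_succ c hcpos m M i hi
  have hw0 := hw_pos c hcpos m M i
  have hw1 := hw_pos c hcpos m M (i+1)
  have hm1' : (m:ℝ) ≤ M + 1 := by exact_mod_cast hm1
  have hm2' : (M:ℝ) ≤ m + 1 := by exact_mod_cast hm2
  have hi' : (i:ℝ) + 1 ≤ M := by exact_mod_cast hi
  have hi0 : (0:ℝ) ≤ i := by positivity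
  have hpl : b * M ≤ c (m+i+1) := by
    refine le_trans ?_ (hbc _)
    push_cast
    apply mul_le_mul_of_nonneg_left (by linarith) hb.le
  have ek : (M - i) + (m + 1 + 2 * i - M) = m+i+1 := by omega
  have ecast : ((m + 1 + 2 * i - M : ℕ):ℝ) = m + 1 + 2 * i - M := by
    rw [Nat.cast_sub (by omega)]; push_cast; ring
  refine ⟨?_, ?_, ?_⟩
  · have hlow := c_lower c a₁ a₂ k₀ hLG hk₀ ha₂ hM (M-i) (m + 1 + 2 * i - M)
    rw [ek, ecast, ← hC₀] at hlow
    have hpu : c (m+i+1) ≤ 3 * a₁ * M := by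
      have := c_incr c a₁ a₂ k₀ hLG 0 (m+i+1)
      rw [hc0, zero_add, sub_zero] at this
      have := (le_abs_self _).trans this
      push_cast at this
      have : a₁ * ((m:ℝ)+i+1) ≤ a₁ * (3 * M) := mul_le_mul_of_nonneg_left (by linarith) ha1.le
      linarith
    have h1 : hw c m M (i+1) = hw c m M i * (c (M-i) / c (m+i+1)) := by
      field_simp; exact hs
    rw [h1]
    apply mul_le_mul_of_nonneg_left _ hw0.le
    have h2 := Real.add_one_le_exp (c (M-i) / c (m+i+1) - 1)
    rw [sub_add_cancel] at h2
    refine h2.trans (Real.exp_le_exp.2 ?_)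
    have h3 : 2 * (a₂/k₀) * i - C₀ ≤ c (m+i+1) - c (M-i) := by
      refine le_trans ?_ hlow
      have : a₂ / k₀ * (2 * i) ≤ a₂ / k₀ * (m + 1 + 2 * i - M) :=
        mul_le_mul_of_nonneg_left (by linarith) (by positivity)
      linarith
    have h4 : (2 * (a₂/k₀) * i - C₀) / c (m+i+1) ≤ (c (m+i+1) - c (M-i)) / c (m+i+1) :=
      div_le_div_of_nonneg_right h3 hp.le
    have h5 : 2 * (a₂/k₀) * i / (3 * a₁ * M) ≤ 2 * (a₂/k₀) * i / c (m+i+1) :=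
      div_le_div_of_nonneg_left (by positivity) hp hpu
    have h6 : C₀ / c (m+i+1) ≤ C₀ / (b * M) :=
      div_le_div_of_nonneg_left (by positivity) (by positivity) hpl
    have h7 : (c (m+i+1) - c (M-i)) / c (m+i+1) = 1 - c (M-i) / c (m+i+1) := by
      field_simp
    have h8 : -(2 * (a₂/k₀) / (3 * a₁) * i - C₀ / b) / M = - (2 * (a₂/k₀) * i / (3 * a₁ * M)) + C₀ / (b * M) := by
      field_simp; ring
    rw [h8]
    rw [sub_div] at h4
    linarith
  · have hup := c_incr c a₁ a₂ k₀ hLG (M-i) (m + 1 + 2 * i - M)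
    rw [ek, ecast] at hup
    have hup := (le_abs_self _).trans hup
    have hql : b * (M - i) ≤ c (M-i) := by
      have := hbc (M-i)
      rwa [Nat.cast_sub hi.le] at this
    have hMi : (0:ℝ) < M - i := by linarith
    have h1 : hw c m M i = hw c m M (i+1) * (c (m+i+1) / c (M-i)) := by
      field_simp; exact hs.symm
    rw [h1]
    apply mul_le_mul_of_nonneg_left _ hw1.le
    refine le_trans ?_ (ratio_low (K₁ := 2 * a₁ / b) (M := M) (i := i) (by positivity) (by linarith) hi0 hi')
    have h2 : a₁ * ((m:ℝ) + 1 + 2 * i - M) ≤ 2 * a₁ * (i+1) := by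
      have := mul_le_mul_of_nonneg_left (by linarith : (m:ℝ) + 1 + 2 * i - M ≤ 2 * (i+1)) ha1.le
      linarith
    have h3 : c (m+i+1) / c (M-i) ≤ 1 + 2 * a₁ * (i+1) / c (M-i) := by
      rw [← sub_le_iff_le_add', div_sub_one hq.ne']
      apply div_le_div_of_nonneg_right _ hq.le
      linarith
    have h4 : 2 * a₁ * (i+1) / c (M-i) ≤ 2 * a₁ * (i+1) / (b * (M-i)) :=
      div_le_div_of_nonneg_left (by positivity) (by positivity) hql
    have h5 : 2 * a₁ / b * ((i+1)/((M:ℝ)-i)) = 2 * a₁ * (i+1) / (b * (M-i)) := by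
      field_simp
    rw [h5]; linarith
  · rw [mul_comm (hw c m M (i+1))]
    exact mul_le_mul_of_nonneg_right hpl hw1.le

lemma sum_split (X : ℕ → ℝ) (m M : ℕ) :
    ∑ k ∈ Finset.range (m + M + 1), X k + X m =
      ∑ i ∈ Finset.range (M+1), X (m+i) + ∑ i ∈ Finset.range (m+1), X (m-i) := by
  have h1 : ∑ i ∈ Finset.range (m+1), X (m-i) = ∑ i ∈ Finset.range (m+1), X i := by
    rw [← Finset.sum_range_reflect X (m+1)]
    apply Finset.sum_congr rfl; intro i _; congr 1
  rw [h1, Finset.sum_range_succ X m, add_assoc m M 1, Finset.sum_range_add]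
  ring

lemma chain_lsi (c : ℕ → ℝ) (a₁ a₂ : ℝ) (k₀ : ℕ)
    (hc0 : c 0 = 0) (hcpos : ∀ n : ℕ, 0 < n → 0 < c n)
    (hLG : ∀ k : ℕ, |c (k + 1) - c k| ≤ a₁)
    (hk₀ : 0 < k₀) (ha₂ : 0 < a₂)
    (hM : ∀ j k : ℕ, j + k₀ ≤ k → a₂ ≤ c k - c j) :
    ∃ C : ℝ, 0 < C ∧ ∀ N : ℕ, ∀ φ : ℕ → ℝ, (∀ k, 0 ≤ φ k) →
      (∑ k ∈ Finset.range (N+1), hw c 0 N k * (φ k^2 * Real.log (φ k ^2))) / (∑ k ∈ Finset.range (N+1), hw c 0 N k)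
      - (∑ k ∈ Finset.range (N+1), hw c 0 N k * φ k^2)/(∑ k ∈ Finset.range (N+1), hw c 0 N k)
        * Real.log ((∑ k ∈ Finset.range (N+1), hw c 0 N k * φ k^2)/(∑ k ∈ Finset.range (N+1), hw c 0 N k)) ≤
      C * ((∑ k ∈ Finset.range (N+1), hw c 0 N k *
        (1/2 * (c k * (φ (k-1) - φ k)^2 + c (N-k) * (φ (k+1) - φ k)^2))) / (∑ k ∈ Finset.range (N+1), hw c 0 N k)) := by
  obtain ⟨δ, C, K, b, hδ, hC, hK, hb, HB⟩ := hw_bounds c a₁ a₂ k₀ hc0 hcpos hLG hk₀ ha₂ hM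
  have hcnn : ∀ k, 0 ≤ c k := by
    intro k; rcases Nat.eq_zero_or_pos k with h | h
    · rw [h, hc0]
    · exact (hcpos k h).le
  -- total mass of a half
  set KM := Real.exp (δ/2 + C) * Real.exp (δ/2) * (1 + 1/δ) + 1 with hKM
  have hKM0 : 0 < KM := by positivity
  have mass : ∀ m M : ℕ, m ≤ M + 1 → M ≤ m + 1 →
      ∑ i ∈ Finset.range (M+1), hw c m M i ≤ KM * √((M:ℝ)+1) * hw c m M 0 := by
    intro m M h1 h2
    have hp := hw_pos c hcpos m M 0
    rcases Nat.eq_zero_or_pos M with h0 | h0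
    · subst h0
      simp
      have : 1 ≤ KM := by rw [hKM]; linarith [(by positivity : 0 ≤ Real.exp (δ/2 + C) * Real.exp (δ/2) * (1 + 1/δ))]
      nlinarith
    · have := half_mass δ C hδ hC M h0 (hw c m M) (fun i _ => hw_pos c hcpos m M i)
        (fun i hi => (HB m M h1 h2 i hi).1)
      refine this.trans ?_
      apply mul_le_mul_of_nonneg_right _ hp.le
      apply mul_le_mul (by rw [hKM]; linarith) (Real.sqrt_le_sqrt (by linarith)) (by positivity) hKM0.le
  obtain ⟨B, hB, HH⟩ := half_hardy δ C K (4 * KM) b hδ hC hK (by positivity) hb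
  have hardyHalf : ∀ m M : ℕ, m ≤ M + 1 → M ≤ m + 1 → ∀ Z, 0 < Z →
      Z ≤ KM * (√((M:ℝ)+1) + √((m:ℝ)+1)) * hw c m M 0 → ∀ (h g : ℕ → ℝ), (∀ i, 0 ≤ h i) →
      ∑ i ∈ Finset.range (M+1), hw c m M i * Real.exp (h i) ≤ 5 * Z → g 0 = 0 →
      ∑ i ∈ Finset.range (M+1), hw c m M i * (1 + h i) * g i ^ 2 ≤
      B * ∑ i ∈ Finset.range M, hw c m M (i+1) * c (m+i+1) * (g (i+1) - g i)^2 := by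
    intro m M h1 h2 Z hZ hZK h g hh hs hg
    have hp := hw_pos c hcpos m M 0
    rcases Nat.eq_zero_or_pos M with h0 | h0
    · subst h0; simp [hg]
    · apply HH M h0 (hw c m M) (fun j => hw c m M j * c (m+j)) Z hZ (fun i _ => hw_pos c hcpos m M i)
        (fun i hi => (HB m M h1 h2 i hi).1) (fun i hi => (HB m M h1 h2 i hi).2.1)
        (fun i hi => (HB m M h1 h2 i hi).2.2) _ h g hh hs hg
      refine hZK.trans ?_
      apply mul_le_mul_of_nonneg_right _ hp.le
      have hM1 : (1:ℝ) ≤ M := by exact_mod_cast h0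
      have hm1 : (m:ℝ) ≤ M + 1 := by exact_mod_cast h1
      have e : √(4 * (M:ℝ)) = 2 * √(M:ℝ) := by
        rw [Real.sqrt_mul (by norm_num)]
        congr 1
        rw [show (4:ℝ) = 2^2 by norm_num]; exact Real.sqrt_sq (by norm_num)
      have e1 : √((M:ℝ)+1) ≤ √(4 * (M:ℝ)) := Real.sqrt_le_sqrt (by linarith)
      have e2 : √((m:ℝ)+1) ≤ √(4 * (M:ℝ)) := Real.sqrt_le_sqrt (by linarith)
      rw [e] at e1 e2
      have := mul_le_mul_of_nonneg_left (add_le_add e1 e2) hKM0.le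
      linarith
  refine ⟨20 * (2 * B) + 1, by positivity, ?_⟩
  intro N φ hφ
  set W := hw c 0 N with hW
  have hWp : ∀ k, 0 < W k := fun k => hw_pos c hcpos 0 N k
  set Z := ∑ k ∈ Finset.range (N+1), W k with hZ
  have hZ0 : 0 < Z := Finset.sum_pos (fun k _ => hWp k) (by simp)
  set D := ∑ k ∈ Finset.range (N+1), W k * (1/2 * (c k * (φ (k-1) - φ k)^2 + c (N-k) * (φ (k+1) - φ k)^2)) with hD
  have hD0 : 0 ≤ D := by
    apply Finset.sum_nonneg; intro k _
    apply mul_nonneg (hWp k).le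
    have := mul_nonneg (hcnn k) (sq_nonneg (φ (k-1) - φ k))
    have := mul_nonneg (hcnn (N-k)) (sq_nonneg (φ (k+1) - φ k))
    linarith
  obtain ⟨m, M, hN, h1, h2⟩ : ∃ m M, N = m + M ∧ m ≤ M + 1 ∧ M ≤ m + 1 :=
    ⟨N / 2, N - N/2, by omega, by omega, by omega⟩
  have WR : ∀ i, W (m+i) = hw c m M i := by
    intro i; simp only [hW, hw]; congr 3 <;> omega
  have WL : ∀ i ≤ m, W (m-i) = hw c M m i := by
    intro i hi; simp only [hW, hw]; rw [mul_comm]; congr 3 <;> omega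
  set a := φ m with ha
  set s := (∑ k ∈ Finset.range (N+1), W k * (φ k - a)^2) / Z with hs
  have hsZ : s * Z = ∑ k ∈ Finset.range (N+1), W k * (φ k - a)^2 := by rw [hs]; field_simp
  have hs0 : 0 ≤ s := div_nonneg (Finset.sum_nonneg fun k _ => mul_nonneg (hWp k).le (sq_nonneg _)) hZ0.le
  rcases hs0.eq_or_lt with h0 | hspos
  · -- constant case
    rw [← h0, zero_mul] at hsZ
    have hz := (Finset.sum_eq_zero_iff_of_nonneg (fun k _ => mul_nonneg (hWp k).le (sq_nonneg (φ k - a)))).1 hsZ.symm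
    have hconst : ∀ k ∈ Finset.range (N+1), φ k = a := by
      intro k hk
      have := hz k hk
      have := (mul_eq_zero.1 this).resolve_left (hWp k).ne'
      have := pow_eq_zero_iff (two_ne_zero) |>.1 this
      linarith
    have e1 : ∑ k ∈ Finset.range (N+1), W k * (φ k^2 * Real.log (φ k ^2)) = Z * (a^2 * Real.log (a^2)) := by
      rw [hZ, Finset.sum_mul]; apply Finset.sum_congr rfl; intro k hk; rw [hconst k hk]
    have e2 : ∑ k ∈ Finset.range (N+1), W k * φ k^2 = Z * a^2 := by
      rw [hZ, Finset.sum_mul]; apply Finset.sum_congr rfl; intro k hk; rw [hconst k hk]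
    rw [e1, e2, mul_div_cancel_left₀ _ hZ0.ne', mul_div_cancel_left₀ _ hZ0.ne', sub_self]
    positivity
  · have hent := ent_bound (Finset.range (N+1)) W φ a Z s (fun k _ => (hWp k).le) hZ hZ0 hφ (hφ m) hspos hsZ
    refine hent.trans ?_
    set h : ℕ → ℝ := fun k => Real.log (1 + 4 * (φ k - a)^2 / s) with hh
    have h1p : ∀ k, 1 ≤ 1 + 4 * (φ k - a)^2 / s := by
      intro k; have : 0 ≤ 4 * (φ k - a)^2 / s := by positivity
      linarith
    have hh0 : ∀ k, 0 ≤ h k := fun k => Real.log_nonneg (h1p k)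
    have hexp : ∑ k ∈ Finset.range (N+1), W k * Real.exp (h k) = 5 * Z := by
      have : ∀ k, W k * Real.exp (h k) = W k + 4 / s * (W k * (φ k - a)^2) := by
        intro k; rw [hh]; simp only; rw [Real.exp_log (by linarith [h1p k])]; ring
      simp_rw [this]
      rw [Finset.sum_add_distrib, ← Finset.mul_sum, ← hsZ, ← hZ]
      field_simp; ring
    have splitle : ∀ X : ℕ → ℝ, (∀ k, 0 ≤ X k) →
        ∑ k ∈ Finset.range (N+1), X k ≤
        ∑ i ∈ Finset.range (M+1), X (m+i) + ∑ i ∈ Finset.range (m+1), X (m-i) := by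
      intro X hX
      have := sum_split X m M
      rw [← hN] at this
      linarith [hX m]
    have rightle : ∀ X : ℕ → ℝ, (∀ k, 0 ≤ X k) →
        ∑ i ∈ Finset.range (M+1), X (m+i) ≤ ∑ k ∈ Finset.range (N+1), X k := by
      intro X hX
      rw [hN, add_assoc, Finset.sum_range_add X m (M+1)]
      linarith [Finset.sum_nonneg (fun k (_ : k ∈ Finset.range m) => hX k)]
    have leftle : ∀ X : ℕ → ℝ, (∀ k, 0 ≤ X k) →
        ∑ i ∈ Finset.range (m+1), X (m-i) ≤ ∑ k ∈ Finset.range (N+1), X k := by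
      intro X hX
      have := sum_split X m M
      rw [← hN] at this
      rw [Finset.sum_range_succ' (fun i => X (m+i)) M] at this
      have h3 := Finset.sum_nonneg (fun k (_ : k ∈ Finset.range M) => hX (m+(k+1)))
      simp only [add_zero] at this
      linarith
    have hw0 : hw c m M 0 = hw c M m 0 := by simp [hw, mul_comm]
    have hZK : Z ≤ KM * (√((M:ℝ)+1) + √((m:ℝ)+1)) * hw c m M 0 := by
      have q1 := splitle W (fun k => (hWp k).le)
      have q2 : ∑ i ∈ Finset.range (M+1), W (m+i) = ∑ i ∈ Finset.range (M+1), hw c m M i :=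
        Finset.sum_congr rfl fun i _ => WR i
      have q3 : ∑ i ∈ Finset.range (m+1), W (m-i) = ∑ i ∈ Finset.range (m+1), hw c M m i :=
        Finset.sum_congr rfl fun i hi => WL i (by have := Finset.mem_range.1 hi; omega)
      have q4 := mass m M h1 h2
      have q5 := mass M m h2 h1
      rw [← hw0] at q5
      rw [q2, q3] at q1
      linarith
    have HR := hardyHalf m M h1 h2 Z hZ0 hZK (fun i => h (m+i)) (fun i => φ (m+i) - a)
      (fun i => hh0 _) (by
        rw [← hexp]
        refine le_trans (le_of_eq ?_) (rightle (fun k => W k * Real.exp (h k)) fun k => mul_nonneg (hWp k).le (Real.exp_pos _).le)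
        exact Finset.sum_congr rfl fun i _ => by rw [WR]) (by simp [ha])
    have HL := hardyHalf M m h2 h1 Z hZ0 (by rw [← hw0, add_comm (√((m:ℝ)+1))]; exact hZK) (fun i => h (m-i)) (fun i => φ (m-i) - a)
      (fun i => hh0 _) (by
        rw [← hexp]
        refine le_trans (le_of_eq ?_) (leftle (fun k => W k * Real.exp (h k)) fun k => mul_nonneg (hWp k).le (Real.exp_pos _).le)
        exact Finset.sum_congr rfl fun i hi => by rw [WL i (by have := Finset.mem_range.1 hi; omega)]) (by simp [ha])
    have q1 := splitle (fun k => W k * (1 + h k) * (φ k - a)^2)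
      (fun k => mul_nonneg (mul_nonneg (hWp k).le (by linarith [hh0 k])) (sq_nonneg _))
    have q2 : ∑ i ∈ Finset.range (M+1), W (m+i) * (1 + h (m+i)) * (φ (m+i) - a)^2
      = ∑ i ∈ Finset.range (M+1), hw c m M i * (1 + h (m+i)) * (φ (m+i) - a)^2 :=
        Finset.sum_congr rfl fun i _ => by rw [WR i]
    have q3 : ∑ i ∈ Finset.range (m+1), W (m-i) * (1 + h (m-i)) * (φ (m-i) - a)^2
      = ∑ i ∈ Finset.range (m+1), hw c M m i * (1 + h (m-i)) * (φ (m-i) - a)^2 :=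
        Finset.sum_congr rfl fun i hi => by rw [WL i (by have := Finset.mem_range.1 hi; omega)]
    rw [q2, q3] at q1
    have DR : ∑ i ∈ Finset.range M, hw c m M (i+1) * c (m+i+1) * ((φ (m+(i+1)) - a) - (φ (m+i) - a))^2
        ≤ ∑ k ∈ Finset.range (N+1), W k * (c k * (φ (k-1) - φ k)^2) := by
      have := rightle (fun k => W k * (c k * (φ (k-1) - φ k)^2))
        (fun k => mul_nonneg (hWp k).le (mul_nonneg (hcnn k) (sq_nonneg _)))
      refine le_trans ?_ this
      rw [Finset.sum_range_succ']
      refine le_trans (le_of_eq ?_) (le_add_of_nonneg_right (mul_nonneg (hWp _).le (mul_nonneg (hcnn _) (sq_nonneg _))))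
      apply Finset.sum_congr rfl; intro i _
      rw [WR]
      have : m + (i+1) - 1 = m + i := by omega
      rw [this, ← add_assoc]; ring
    have DL : ∑ i ∈ Finset.range m, hw c M m (i+1) * c (M+i+1) * ((φ (m-(i+1)) - a) - (φ (m-i) - a))^2
        ≤ ∑ k ∈ Finset.range (N+1), W k * (c (N-k) * (φ (k+1) - φ k)^2) := by
      have := leftle (fun k => W k * (c (N-k) * (φ (k+1) - φ k)^2))
        (fun k => mul_nonneg (hWp k).le (mul_nonneg (hcnn _) (sq_nonneg _)))
      refine le_trans ?_ this
      rw [Finset.sum_range_succ']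
      refine le_trans (le_of_eq ?_) (le_add_of_nonneg_right (mul_nonneg (hWp _).le (mul_nonneg (hcnn _) (sq_nonneg _))))
      apply Finset.sum_congr rfl; intro i hi
      have hi := Finset.mem_range.1 hi
      rw [WL (i+1) (by omega)]
      have e1 : m - (i+1) + 1 = m - i := by omega
      have e2 : N - (m - (i+1)) = M + i + 1 := by omega
      rw [e1, e2]; ring
    have DD : 2 * D = ∑ k ∈ Finset.range (N+1), W k * (c k * (φ (k-1) - φ k)^2)
        + ∑ k ∈ Finset.range (N+1), W k * (c (N-k) * (φ (k+1) - φ k)^2) := by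
      rw [hD, Finset.mul_sum, ← Finset.sum_add_distrib]
      apply Finset.sum_congr rfl; intro k _; ring
    have fin : ∑ k ∈ Finset.range (N+1), W k * (1 + h k) * (φ k - a)^2 ≤ B * (2 * D) := by
      rw [DD, mul_add]
      have := mul_le_mul_of_nonneg_left DR hB
      have := mul_le_mul_of_nonneg_left DL hB
      linarith
    have fin2 := div_le_div_of_nonneg_right fin hZ0.le
    have : 0 ≤ D / Z := by positivity
    calc _ ≤ 20 * (B * (2 * D) / Z) := mul_le_mul_of_nonneg_left fin2 (by norm_num)
      _ = 20 * (2 * B) * (D/Z) := by ring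
      _ ≤ _ := by nlinarith

/-- two-site configuration -/
def conf (a : ℤ) (N k : ℕ) : ℤ → ℕ := fun z => if z = a then k else if z = a + 1 then N - k else 0

lemma Ico_two (a : ℤ) : Finset.Ico a (a+2) = {a, a+1} := by
  ext x; simp only [Finset.mem_Ico, Finset.mem_insert, Finset.mem_singleton]; omega

lemma sum_two (a : ℤ) (F : ℤ → ℝ) : ∑ x ∈ Finset.Ico a (a+2), F x = F a + F (a+1) := by
  rw [Ico_two, Finset.sum_pair (by omega)]

lemma conf_inj (a : ℤ) (N : ℕ) : Function.Injective (conf a N) := by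
  intro k l h
  have := congrFun h a
  simpa [conf] using this

lemma nuW_conf (c : ℕ → ℝ) (a : ℤ) (N k : ℕ) (hk : k ≤ N) :
    nuW c (Finset.Ico a (a+2)) N (conf a N k) = hw c 0 N k := by
  unfold nuW
  rw [Set.indicator_of_mem]
  · rw [Ico_two, Finset.prod_pair (by omega)]
    simp [conf, hw]
  · constructor
    · intro x hx
      rw [Ico_two] at hx
      simp only [Finset.mem_insert, Finset.mem_singleton, not_or] at hx
      simp [conf, hx.1, hx.2]
    · rw [Ico_two, Finset.sum_pair (by omega)]
      simp [conf]; omega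

lemma tsum_nuW (c : ℕ → ℝ) (a : ℤ) (N : ℕ) (F : (ℤ → ℕ) → ℝ) :
    ∑' η, nuW c (Finset.Ico a (a+2)) N η * F η = ∑ k ∈ Finset.range (N+1), hw c 0 N k * F (conf a N k) := by
  classical
  rw [tsum_eq_sum (s := (Finset.range (N+1)).image (conf a N))]
  · rw [Finset.sum_image (fun x _ y _ h => conf_inj a N h)]
    apply Finset.sum_congr rfl; intro k hk
    rw [nuW_conf c a N k (by have := Finset.mem_range.1 hk; omega)]
  · intro η hη
    unfold nuW
    rw [Set.indicator_of_notMem, zero_mul]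
    rintro ⟨h1, h2⟩
    apply hη
    rw [Ico_two] at h1
    rw [Ico_two, Finset.sum_pair (by omega)] at h2
    refine Finset.mem_image.2 ⟨η a, Finset.mem_range.2 (by omega), ?_⟩
    funext z
    unfold conf
    split_ifs with h3 h4
    · rw [h3]
    · rw [h4]; omega
    · exact (h1 z (by simp [h3, h4])).symm

lemma wE_nuW (c : ℕ → ℝ) (a : ℤ) (N : ℕ) (F : (ℤ → ℕ) → ℝ) :
    wE (nuW c (Finset.Ico a (a+2)) N) F =
      (∑ k ∈ Finset.range (N+1), hw c 0 N k * F (conf a N k)) / ∑ k ∈ Finset.range (N+1), hw c 0 N k := by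
  unfold wE
  rw [tsum_nuW]
  congr 1
  have := tsum_nuW c a N (fun _ => 1)
  simpa using this

lemma move_right (a : ℤ) (N k : ℕ) (hk : k ≤ N) (h : 0 < k) :
    move (conf a N k) a (a+1) = conf a N (k-1) := by
  funext z
  unfold move conf
  by_cases h1 : z = a
  · simp [h1]
  · by_cases h2 : z = a + 1
    · simp [h2]; omega
    · simp [h1, h2]

lemma move_left (a : ℤ) (N k : ℕ) (hk : k < N) :
    move (conf a N k) (a+1) a = conf a N (k+1) := by
  funext z
  unfold move conf
  by_cases h1 : z = a
  · simp [h1]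
  · by_cases h2 : z = a + 1
    · simp [h2]; omega
    · simp [h1, h2]

/-- Proposition 3.7: uniform (in `N`) logarithmic Sobolev inequality on two adjacent sites. -/
theorem statement9
    (c : ℕ → ℝ) (a₁ a₂ : ℝ) (k₀ : ℕ)
    (hc0 : c 0 = 0) (hcpos : ∀ n : ℕ, 0 < n → 0 < c n)
    (hLG : ∀ k : ℕ, |c (k + 1) - c k| ≤ a₁)
    (hk₀ : 0 < k₀) (ha₂ : 0 < a₂)
    (hM : ∀ j k : ℕ, j + k₀ ≤ k → a₂ ≤ c k - c j) :
    ∃ C : ℝ, 0 < C ∧ ∀ (a : ℤ) (N : ℕ), 1 ≤ N →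
      ∀ f : (ℤ → ℕ) → ℝ, (∀ η, 0 ≤ f η) →
        wEnt (nuW c (Finset.Ico a (a + 2)) N) f ≤
          C * wDir c (Finset.Ico a (a + 2)) (nuW c (Finset.Ico a (a + 2)) N)
            (fun η => Real.sqrt (f η)) (fun η => Real.sqrt (f η)) := by
  obtain ⟨C, hC, H⟩ := chain_lsi c a₁ a₂ k₀ hc0 hcpos hLG hk₀ ha₂ hM
  refine ⟨C, hC, ?_⟩
  intro a N hN f hf
  have h := H N (fun k => Real.sqrt (f (conf a N k))) (fun k => Real.sqrt_nonneg _)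
  have hsq : ∀ k, Real.sqrt (f (conf a N k)) ^ 2 = f (conf a N k) := fun k => Real.sq_sqrt (hf _)
  simp only [hsq] at h
  unfold wEnt wDir
  rw [wE_nuW, wE_nuW, wE_nuW]
  refine h.trans (le_of_eq ?_)
  congr 2
  apply Finset.sum_congr rfl
  intro k hk
  have hk : k ≤ N := by have := Finset.mem_range.1 hk; omega
  congr 1
  rw [sum_two, sum_two, sum_two]
  have e1 : |a - (a+1)| = 1 := by rw [show a - (a+1) = -1 by ring]; rfl
  have e2 : |a + 1 - a| = 1 := by rw [show a + 1 - a = 1 by ring]; rfl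
  have e3 : conf a N k a = k := by simp [conf]
  have e4 : conf a N k (a+1) = N - k := by simp [conf]
  rw [if_pos e1, if_pos e2, if_neg (by simp), if_neg (by simp), e3, e4, zero_add, add_zero]
  congr 2
  · rcases Nat.eq_zero_or_pos k with h0 | h0
    · simp [h0, hc0]
    · rw [move_right a N k hk h0]; ring
  · rcases hk.eq_or_lt with h0 | h0
    · simp [h0, hc0]
    · rw [move_left a N k h0]; ring
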